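/- Suppose f_0 : A → ℝ satisfies ⟨f_0,h⟩ = Σ_{(i,j)∈A} f_0(i,j)h(i,j) = 0 for every h : A → ℝ with zero line sums with respect to S. Put D = Σ_{(i,j)∈A} f_0(i,j) and E = Σ_{(i,j)∈A} min(f_0(i,j)², (1 − f_0(i,j))²), and let F : A → {0,1} be a nearest-integer rounding of f_0, i.e. (F(i,j) − f_0(i,j))² = min(f_0(i,j)², (1 − f_0(i,j))²) for all (i,j) ∈ A. Let s be a natural number such that every subset B ⊆ A with exactly s+1 elements satisfies Σ_{(i,j)∈B} |2 f_0(i,j) − 1| > D − E − Σ_{(i,j)∈A} f_0(i,j)². Then every g : A → {0,1} having the same line sums as f_0 with respect to S satisfies g(i,j) = F(i,j) for at least mn − s pairs (i,j) ∈ A. -/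

import Mathlib

open scoped Classical

/-- `(a,b)` is a direction: coprime entries and `a ≥ 0`. -/
def IsDirection (d : ℤ × ℤ) : Prop := Int.gcd d.1 d.2 = 1 ∧ 0 ≤ d.1

/-- The line sum of `f : A → ℝ` along the line `a·j = b·i + t` for the direction
`d = (a,b)`, where `A = {0,…,m−1} × {0,…,n−1}`. -/
noncomputable def lineSum (m n : ℕ) (f : Fin m × Fin n → ℝ) (d : ℤ × ℤ) (t : ℤ) : ℝ :=
  ∑ p ∈ Finset.univ.filter
      (fun p : Fin m × Fin n => d.1 * (p.2 : ℤ) = d.2 * (p.1 : ℤ) + t), f p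

theorem lineSum_sub (m n : ℕ) (f g : Fin m × Fin n → ℝ) (d : ℤ × ℤ) (t : ℤ) :
    lineSum m n (fun p => f p - g p) d t = lineSum m n f d t - lineSum m n g d t := by
  simp only [lineSum, Finset.sum_sub_distrib]

/-- The lines in a fixed direction partition the grid. -/
theorem sum_eq_zero_of_lineSum_eq_zero (m n : ℕ) (f : Fin m × Fin n → ℝ) (d : ℤ × ℤ)
    (hf : ∀ t, lineSum m n f d t = 0) : ∑ p, f p = 0 := by
  rw [← Finset.sum_fiberwise_of_maps_to (s := Finset.univ)
    (t := Finset.univ.image fun p : Fin m × Fin n => d.1 * (p.2 : ℤ) - d.2 * (p.1 : ℤ))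
    (g := fun p => d.1 * (p.2 : ℤ) - d.2 * (p.1 : ℤ))
    (fun p _ => Finset.mem_image_of_mem _ (Finset.mem_univ p))]
  refine Finset.sum_eq_zero fun t _ => ?_
  rw [← hf t, lineSum]
  refine Finset.sum_congr (Finset.filter_congr fun p _ => ?_) fun _ _ => rfl
  exact sub_eq_iff_eq_add'

/-- Replacing a nearest binary value `y` of `x` by the other one increases the squared distance
to `x` by `|2 * x - 1|`. -/
theorem sq_sub_sub_min_sq {x y z : ℝ} (hy : y = 0 ∨ y = 1) (hz : z = 0 ∨ z = 1)
    (hyx : (y - x) ^ 2 = min (x ^ 2) ((1 - x) ^ 2)) :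
    (z - x) ^ 2 - min (x ^ 2) ((1 - x) ^ 2) = if z = y then 0 else |2 * x - 1| := by
  have h₁ := min_le_left (x ^ 2) ((1 - x) ^ 2)
  have h₂ := min_le_right (x ^ 2) ((1 - x) ^ 2)
  rw [← hyx] at h₁ h₂ ⊢
  rcases hy with rfl | rfl <;> rcases hz with rfl | rfl
  · simp
  · rw [if_neg one_ne_zero, abs_of_nonpos (by linarith)]
    ring
  · rw [if_neg zero_ne_one, abs_of_nonneg (by linarith)]
    ring
  · simp

/-- Theorem 4.3 (a): every binary solution `g` agrees with the rounding `F` of `f₀`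
on at least `mn − s` pixels. -/
theorem stmt_7 (m n : ℕ) (hm : 0 < m) (hn : 0 < n)
    (S : Finset (ℤ × ℤ)) (hS : S.Nonempty) (hSdir : ∀ d ∈ S, IsDirection d)
    (f0 : Fin m × Fin n → ℝ)
    (horth : ∀ h : Fin m × Fin n → ℝ,
      (∀ d ∈ S, ∀ t : ℤ, lineSum m n h d t = 0) →
      ∑ p : Fin m × Fin n, f0 p * h p = 0)
    (D E : ℝ)
    (hD : D = ∑ p : Fin m × Fin n, f0 p)
    (hE : E = ∑ p : Fin m × Fin n, min ((f0 p) ^ 2) ((1 - f0 p) ^ 2))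
    (F : Fin m × Fin n → ℝ) (hF01 : ∀ p, F p = 0 ∨ F p = 1)
    (hFround : ∀ p : Fin m × Fin n,
      (F p - f0 p) ^ 2 = min ((f0 p) ^ 2) ((1 - f0 p) ^ 2))
    (s : ℕ)
    (hs : ∀ B : Finset (Fin m × Fin n), B.card = s + 1 →
      ∑ p ∈ B, |2 * f0 p - 1| > D - E - ∑ p : Fin m × Fin n, (f0 p) ^ 2) :
    ∀ g : Fin m × Fin n → ℝ, (∀ p, g p = 0 ∨ g p = 1) →
      (∀ d ∈ S, ∀ t : ℤ, lineSum m n g d t = lineSum m n f0 d t) →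
      m * n - s ≤ (Finset.univ.filter (fun p : Fin m × Fin n => g p = F p)).card := by
  intro g hg hline
  have hzero : ∀ d ∈ S, ∀ t, lineSum m n (fun p => g p - f0 p) d t = 0 := fun d hd t => by
    rw [lineSum_sub, hline d hd t, sub_self]
  have hsum : ∑ p, (g p - f0 p) = 0 :=
    hS.elim fun d hd => sum_eq_zero_of_lineSum_eq_zero m n _ d (hzero d hd)
  have hdist : ∑ p, (g p - f0 p) ^ 2 = D - ∑ p, f0 p ^ 2 := by
    have hexpand : ∀ p, (g p - f0 p) ^ 2 =
        (g p - f0 p) + f0 p - 2 * (f0 p * (g p - f0 p)) - f0 p ^ 2 := fun p => by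
      have hsq : g p ^ 2 = g p := by rcases hg p with h | h <;> simp [h]
      linear_combination hsq
    simp only [hexpand]
    rw [Finset.sum_sub_distrib, Finset.sum_sub_distrib, Finset.sum_add_distrib,
      ← Finset.mul_sum, horth _ hzero, hsum, hD]
    ring
  have hexcess : ∑ p with ¬ g p = F p, |2 * f0 p - 1| = D - E - ∑ p, f0 p ^ 2 := by
    have h : ∑ p, ((g p - f0 p) ^ 2 - min (f0 p ^ 2) ((1 - f0 p) ^ 2)) =
        ∑ p, if g p = F p then 0 else |2 * f0 p - 1| :=
      Finset.sum_congr rfl fun p _ => sq_sub_sub_min_sq (hF01 p) (hg p) (hFround p)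
    rw [Finset.sum_sub_distrib, hdist, ← hE] at h
    rw [Finset.sum_filter]
    simp only [ite_not]
    linarith
  have hcard : (Finset.univ.filter fun p => ¬ g p = F p).card ≤ s := by
    by_contra! hlt
    obtain ⟨B, hB, hBcard⟩ := Finset.exists_subset_card_eq (Nat.succ_le_of_lt hlt)
    have hle := Finset.sum_le_sum_of_subset_of_nonneg (f := fun p => |2 * f0 p - 1|) hB
      fun _ _ _ => abs_nonneg _
    linarith [hs B hBcard]
  have htotal := Finset.card_filter_add_card_filter_not (s := Finset.univ) (fun p => g p = F p)
  simp only [Finset.card_univ, Fintype.card_prod, Fintype.card_fin] at htotal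
  omega
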